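/- In the one-way communication model where Alice holds G_A and Bob holds G_B on a common vertex set, if Alice sends an EDCS H = EDCS(G_A, β, β-1) with β = 32·ε^{-2}·log(1/ε), then μ(G_A ∪ G_B) ≤ (3/2 + ε)·μ(H ∪ G_B). -/

import Mathlib

open SimpleGraph

/-- The degree of a vertex in a simple graph. -/
noncomputable def deg {V : Type*} (G : SimpleGraph V) (v : V) : ℕ := (G.neighborSet v).ncard

/-- The maximum matching size of a simple graph. -/
noncomputable def matchNum {V : Type*} (G : SimpleGraph V) : ℕ :=
  sSup {n | ∃ M : G.Subgraph, M.IsMatching ∧ M.edgeSet.ncard = n}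

open Finset in
open Classical in
lemma even_card_of_involution {V : Type*} (s : Finset V) (p : V → V)
    (hp : ∀ v, p (p v) = v) (hs : ∀ v ∈ s, p v ∈ s) (hne : ∀ v ∈ s, p v ≠ v) : Even #s := by
  have h : ∑ v ∈ s, (1 : ZMod 2) = 0 :=
    Finset.sum_involution (fun v _ => p v) (fun _ _ => by decide) (fun v hv _ => hne v hv)
      hs (fun v _ => hp v)
  rw [sum_const, nsmul_eq_mul, mul_one] at h
  exact (ZMod.natCast_eq_zero_iff_even).1 h

open Classical in
lemma SimpleGraph.Subgraph.IsMatching.two_mul_ncard_edgeSet {V : Type*} [Fintype V]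
    {G : SimpleGraph V} {M : G.Subgraph} (hM : M.IsMatching) :
    2 * M.edgeSet.ncard = M.verts.ncard := by
  have h := M.spanningCoe.sum_degrees_eq_twice_card_edges
  have hE : M.spanningCoe.edgeFinset.card = M.edgeSet.ncard := by
    rw [← Set.ncard_coe_finset, coe_edgeFinset, Subgraph.edgeSet_spanningCoe]
  have hd : ∀ v, M.spanningCoe.degree v = if v ∈ M.verts then 1 else 0 := by
    intro v
    split_ifs with hv
    · rw [SimpleGraph.degree, Finset.card_eq_one]
      obtain ⟨w, hw, hw'⟩ := hM hv
      refine ⟨w, ?_⟩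
      ext x
      simp only [mem_neighborFinset, Subgraph.spanningCoe_adj, Finset.mem_singleton]
      exact ⟨hw' x, fun h => h ▸ hw⟩
    · rw [SimpleGraph.degree, Finset.card_eq_zero, Finset.eq_empty_iff_forall_notMem]
      intro x hx
      exact hv (M.edge_vert (by simpa using hx))
  rw [← hE, ← h, Finset.sum_congr rfl (fun v _ => hd v), Finset.sum_boole, Nat.cast_id,
    ← Set.ncard_coe_finset]
  congr 1
  ext; simp

lemma bddAbove_matching_sizes {V : Type*} [Fintype V] (G : SimpleGraph V) :
    BddAbove {n | ∃ M : G.Subgraph, M.IsMatching ∧ M.edgeSet.ncard = n} := by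
  refine ⟨(Set.univ : Set (Sym2 V)).ncard, ?_⟩
  rintro n ⟨M, -, rfl⟩
  exact Set.ncard_le_ncard (Set.subset_univ _)

lemma exists_isMatching_ncard_eq_matchNum {V : Type*} [Fintype V] (G : SimpleGraph V) :
    ∃ M : G.Subgraph, M.IsMatching ∧ M.edgeSet.ncard = matchNum G :=
  Nat.sSup_mem (s := {n | ∃ M : G.Subgraph, M.IsMatching ∧ M.edgeSet.ncard = n})
    ⟨_, ⊥, fun v hv => by simp at hv, rfl⟩ (bddAbove_matching_sizes G)

open Finset in
open Classical in
lemma card_le_two_mul_matchNum {V : Type*} [Fintype V] (G : SimpleGraph V) (p : V → V)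
    (hp : ∀ v, p (p v) = v) (hG : ∀ v, p v ≠ v → G.Adj v (p v)) :
    #{v | p v ≠ v} ≤ 2 * matchNum G := by
  let M : G.Subgraph :=
    { verts := {v | p v ≠ v}
      Adj := fun u v => p u = v ∧ u ≠ v
      adj_sub := by
        rintro u v ⟨rfl, h⟩
        exact hG u h.symm
      edge_vert := by
        rintro u v ⟨rfl, h⟩
        exact h.symm
      symm := ⟨by
        rintro u v ⟨rfl, h⟩
        exact ⟨hp u, h.symm⟩⟩ }
  have hM : M.IsMatching := by
    intro v hv
    exact ⟨p v, ⟨rfl, Ne.symm hv⟩, fun w hw => hw.1.symm⟩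
  have h1 := hM.two_mul_ncard_edgeSet
  have h2 : M.edgeSet.ncard ≤ matchNum G :=
    le_csSup (bddAbove_matching_sizes G) ⟨M, hM, rfl⟩
  have h3 : M.verts.ncard = #{v | p v ≠ v} := by
    rw [← Set.ncard_coe_finset]
    congr 1
    ext; simp [M]
  omega

open Classical in
lemma SimpleGraph.Subgraph.IsMatching.exists_involution {V : Type*} {G : SimpleGraph V}
    {M : G.Subgraph} (hM : M.IsMatching) :
    ∃ p : V → V, (∀ v, p (p v) = v) ∧ (∀ v, p v ≠ v → G.Adj v (p v)) ∧
      ∀ v, p v ≠ v ↔ v ∈ M.verts := by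
  choose! f hf using show ∀ v ∈ M.verts, ∃! w, M.Adj v w from fun _ hv => hM hv
  have hadj : ∀ v ∈ M.verts, M.Adj v (f v) := fun v hv => (hf v hv).1
  have hmem : ∀ v ∈ M.verts, f v ∈ M.verts := fun v hv => M.edge_vert (hadj v hv).symm
  refine ⟨fun v => if v ∈ M.verts then f v else v, fun v => ?_, fun v => ?_, fun v => ?_⟩
  · by_cases hv : v ∈ M.verts
    · simp only [hv, if_true, hmem v hv]
      exact ((hf (f v) (hmem v hv)).2 v (hadj v hv).symm).symm
    · simp [hv]
  · by_cases hv : v ∈ M.verts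
    · simpa [hv] using fun _ => M.adj_sub (hadj v hv)
    · simp [hv]
  · by_cases hv : v ∈ M.verts
    · simpa [hv] using (M.adj_sub (hadj v hv)).ne'
    · simp [hv]

open Finset in
open Classical in
lemma exists_involution_card_eq {V : Type*} [Fintype V] (G : SimpleGraph V) :
    ∃ p : V → V, (∀ v, p (p v) = v) ∧ (∀ v, p v ≠ v → G.Adj v (p v)) ∧
      #{v | p v ≠ v} = 2 * matchNum G := by
  obtain ⟨M, hM, hcard⟩ := exists_isMatching_ncard_eq_matchNum G
  obtain ⟨p, hp, hG, hv⟩ := hM.exists_involution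
  refine ⟨p, hp, hG, ?_⟩
  rw [← hcard, hM.two_mul_ncard_edgeSet, ← Set.ncard_coe_finset]
  congr 1
  ext; simp [hv]

/-- The join of a graph with a complete graph on `k` vertices. -/
def joinComplete {V : Type*} (H : SimpleGraph V) (k : ℕ) : SimpleGraph (V ⊕ Fin k) where
  Adj x y := x ≠ y ∧ ∀ u v, x = Sum.inl u → y = Sum.inl v → H.Adj u v
  symm := ⟨fun _ _ h => ⟨h.1.symm, fun u v hu hv => (h.2 v u hv hu).symm⟩⟩
  loopless := ⟨fun _ h => h.1 rfl⟩

open Finset in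
open Classical in
lemma card_le_of_joinComplete_isPerfectMatching {V : Type*} [Fintype V] (H : SimpleGraph V)
    (k : ℕ) (M : (joinComplete H k).Subgraph) (hM : M.IsPerfectMatching) :
    Fintype.card V ≤ 2 * matchNum H + k := by
  obtain ⟨q, hq, hadj, hne⟩ := hM.1.exists_involution
  have hne' : ∀ x, q x ≠ x := fun x => (hne x).2 (hM.2 x)
  let p : V → V := fun v => Sum.elim id (fun _ => v) (q (Sum.inl v))
  have hpl : ∀ v w, q (Sum.inl v) = Sum.inl w → p v = w := fun v w h => by simp [p, h]
  have hpr : ∀ v j, q (Sum.inl v) = Sum.inr j → p v = v := fun v j h => by simp [p, h]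
  have hp : ∀ v, p (p v) = v := by
    intro v
    rcases h : q (Sum.inl v) with w | j
    · rw [hpl v w h]
      exact hpl w v (by rw [← h, hq])
    · rw [hpr v j h, hpr v j h]
  have hH : ∀ v, p v ≠ v → H.Adj v (p v) := by
    intro v hv
    rcases h : q (Sum.inl v) with w | j
    · rw [hpl v w h]
      exact (hadj _ (hne' _)).2 v w rfl h
    · exact absurd (hpr v j h) hv
  have h1 := card_le_two_mul_matchNum H p hp hH
  have h2 : #{v | ¬ p v ≠ v} ≤ k := by
    have : ∀ v ∈ ({v | ¬ p v ≠ v} : Finset V), ∃ j : Fin k, q (Sum.inl v) = Sum.inr j := by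
      intro v hv
      rcases h : q (Sum.inl v) with w | j
      · have : p v = v := by simpa using hv
        rw [hpl v w h] at this
        subst this
        exact absurd h (hne' _)
      · exact ⟨j, rfl⟩
    calc _ ≤ #((univ : Finset (Fin k)).map ⟨Sum.inr, Sum.inr_injective⟩ : Finset (V ⊕ Fin k)) := by
          refine card_le_card_of_injOn (fun v => q (Sum.inl v)) (fun v hv => ?_) ?_
          · obtain ⟨j, hj⟩ := this v hv
            simp [hj]
          · intro v _ w _ h
            have := congrArg q h
            simp only [hq] at this
            exact Sum.inl_injective this
      _ = k := by simp
  have h3 := card_filter_add_card_filter_not (s := (univ : Finset V)) (fun v => p v ≠ v)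
  rw [card_univ] at h3
  omega

open Finset in
open Classical in
/-- The hard direction of the Tutte-Berge formula. The barrier consists of the vertices labelled
`none`; the other vertices are labelled by their component after deletion of the barrier. -/
lemma exists_tutteBerge_labelling {V : Type u} [Fintype V] (H : SimpleGraph V) :
    ∃ (ι : Type u) (_ : Fintype ι) (c : V → Option ι),
      (∀ u v, H.Adj u v → c u = none ∨ c v = none ∨ c u = c v) ∧
      #{v | c v = none} + ∑ i, #{v | c v = some i} / 2 ≤ matchNum H := by
  by_cases hd : Fintype.card V ≤ 2 * matchNum H + 1
  · refine ⟨PUnit, inferInstance, fun _ => some ⟨⟩, by simp, ?_⟩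
    simp
    omega
  obtain ⟨k, hk⟩ : ∃ k, Fintype.card V = 2 * matchNum H + 2 + k :=
    ⟨_, (Nat.add_sub_of_le (by omega)).symm⟩
  have hno : ¬ ∃ M : (joinComplete H k).Subgraph, M.IsPerfectMatching := by
    rintro ⟨M, hM⟩
    have := card_le_of_joinComplete_isPerfectMatching H k M hM
    omega
  rw [tutte] at hno
  push Not at hno
  obtain ⟨W, hW⟩ := hno
  let D := (⊤ : (joinComplete H k).Subgraph).deleteVerts W
  let K := D.coe
  have hD : ∀ x, x ∈ D.verts ↔ x ∉ W := by simp [D]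
  have hKadj : ∀ x y : D.verts, K.Adj x y ↔ (joinComplete H k).Adj x y := by
    rintro ⟨x, hx⟩ ⟨y, hy⟩
    have hx' := (hD x).1 hx
    have hy' := (hD y).1 hy
    simp [K, D, hx', hy']
  have hWodd : W.ncard < K.oddComponents.ncard := hW
  have hcardK : Nat.card D.verts + W.ncard = Fintype.card V + k := by
    have h1 : D.verts = Wᶜ := by ext x; simp [hD]
    have h2 := Set.ncard_add_ncard_compl W
    rw [Nat.card_coe_set_eq, h1, add_comm, h2, Nat.card_eq_fintype_card]
    simp
  have hpar := K.odd_ncard_oddComponents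
  have hodd2 : W.ncard + 2 ≤ K.oddComponents.ncard := by
    rw [Nat.odd_iff, Nat.odd_iff] at hpar
    omega
  have hinr : ∀ j : Fin k, Sum.inr j ∈ W := by
    intro j
    by_contra hj
    have hsub : K.oddComponents ⊆ {K.connectedComponentMk ⟨Sum.inr j, (hD _).2 hj⟩} := by
      intro C _
      induction C using ConnectedComponent.ind with
      | h x =>
        rw [Set.mem_singleton_iff, ConnectedComponent.eq]
        by_cases hx : x = ⟨Sum.inr j, (hD _).2 hj⟩
        · rw [hx]
        · refine Adj.reachable ((hKadj _ _).2 ⟨fun h => hx (Subtype.ext h), ?_⟩)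
          intro u v _ h
          exact absurd h (by simp)
    have := Set.ncard_le_ncard hsub
    rw [Set.ncard_singleton] at this
    omega
  let c : V → Option K.ConnectedComponent := fun v =>
    if h : Sum.inl v ∈ W then none else some (K.connectedComponentMk ⟨Sum.inl v, (hD _).2 h⟩)
  have hcnone : ∀ v, c v = none ↔ Sum.inl v ∈ W := by
    intro v
    by_cases h : Sum.inl v ∈ W <;> simp [c, h]
  have hcsome : ∀ v (h : Sum.inl v ∉ W),
      c v = some (K.connectedComponentMk ⟨Sum.inl v, (hD _).2 h⟩) := by
    intro v h
    simp [c, h]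
  refine ⟨K.ConnectedComponent, Fintype.ofFinite _, c, ?_, ?_⟩
  · intro u v huv
    by_cases hu : Sum.inl u ∈ W
    · exact Or.inl ((hcnone u).2 hu)
    by_cases hv : Sum.inl v ∈ W
    · exact Or.inr (Or.inl ((hcnone v).2 hv))
    refine Or.inr (Or.inr ?_)
    rw [hcsome u hu, hcsome v hv, Option.some_inj, ConnectedComponent.eq]
    refine Adj.reachable ((hKadj _ _).2 ⟨fun h => huv.ne (Sum.inl_injective h), ?_⟩)
    intro a b ha hb
    rwa [← Sum.inl_injective ha, ← Sum.inl_injective hb]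
  · let _ : Fintype K.ConnectedComponent := Fintype.ofFinite _
    have hsupp : ∀ i : K.ConnectedComponent, #{v | c v = some i} = i.supp.ncard := by
      intro i
      have : i.supp = (fun v : V => if h : Sum.inl v ∈ W then
          (i.out : D.verts) else ⟨Sum.inl v, (hD _).2 h⟩) '' {v | c v = some i} := by
        ext x
        simp only [ConnectedComponent.mem_supp_iff, Set.mem_image, Set.mem_ofPred_eq]
        constructor
        · rintro rfl
          obtain ⟨x | j, hx⟩ := x
          · exact ⟨x, hcsome x ((hD _).1 hx), by simp [(hD _).1 hx]⟩
          · exact absurd (hinr j) ((hD _).1 hx)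
        · rintro ⟨v, hv, rfl⟩
          by_cases h : Sum.inl v ∈ W
          · rw [(hcnone v).2 h] at hv
            simp at hv
          · rw [hcsome v h] at hv
            simpa [h] using hv
      rw [this, Set.InjOn.ncard_image, ← Set.ncard_coe_finset]
      · simp
      · intro v hv w hw h
        have hv' : Sum.inl v ∉ W := fun h => by
          rw [Set.mem_ofPred_eq, (hcnone v).2 h] at hv; simp at hv
        have hw' : Sum.inl w ∉ W := fun h => by
          rw [Set.mem_ofPred_eq, (hcnone w).2 h] at hw; simp at hw
        simpa [hv', hw'] using h
    have hU : #{v | c v = none} + k = W.ncard := by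
      have : W = ((({v | c v = none} : Finset V).disjSum (univ : Finset (Fin k)) :
          Finset (V ⊕ Fin k)) : Set (V ⊕ Fin k)) := by
        ext (v | j)
        · simp [hcnone]
        · simp [hinr]
      rw [this, Set.ncard_coe_finset, card_disjSum]
      simp [hcnone]
    have hodd : K.oddComponents.ncard = ∑ i, #{v | c v = some i} % 2 := by
      have h1 : K.oddComponents = ((({i | Odd i.supp.ncard} : Finset K.ConnectedComponent)) :
          Set K.ConnectedComponent) := by ext; simp
      rw [h1, Set.ncard_coe_finset, card_filter]
      refine sum_congr rfl fun i _ => ?_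
      rw [hsupp]
      split_ifs with h
      · exact (Nat.odd_iff.1 h).symm
      · exact (Nat.not_odd_iff.1 h).symm
    have htot : Fintype.card V = #{v | c v = none} + ∑ i, #{v | c v = some i} := by
      rw [← card_univ, card_eq_sum_card_fiberwise (f := c) (t := univ) (fun _ _ => mem_coe.2 (mem_univ _)),
        Fintype.sum_option]
    have hdiv : ∑ i, #{v | c v = some i} =
        2 * ∑ i, #{v | c v = some i} / 2 + ∑ i, #{v | c v = some i} % 2 := by
      rw [mul_sum, ← sum_add_distrib]
      exact sum_congr rfl fun i _ => (Nat.div_add_mod _ 2).symm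
    omega

open Finset in
open Classical in
/-- Here `w * deg` is bounded by `y`, and each vertex of `S ⊆ C` is charged for its edges
inside `C`. -/
lemma sum_mul_inner_degree_le {V : Type*} (H : SimpleGraph V) (C S : Finset V)
    (hSC : S ⊆ C) (hS : S.Nonempty) (y : V → ℝ) (w : ℝ) (hw : 0 < w) (hw45 : 45 * w ≤ 1)
    (hyC : ∀ v ∈ C, w * #{t ∈ C | H.Adj v t} ≤ y v)
    (hedge : ∀ u v, H.Adj u v → y u + y v ≤ 2) :
    ∑ s ∈ S, y s * (w * #{t ∈ C | H.Adj s t}) ≤ 14 / 15 * ((#S : ℝ) - 1) + ((#C : ℝ) - 1) / 2 := by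
  have hS1 : (1 : ℝ) ≤ #S := by exact_mod_cast hS.card_pos
  have hSn : (#S : ℝ) ≤ #C := by exact_mod_cast card_le_card hSC
  have hy0 : ∀ v ∈ C, 0 ≤ y v := fun v hv => le_trans (by positivity) (hyC v hv)
  have hz : ∀ v ∈ C, (#{t ∈ C | H.Adj v t} : ℝ) ≤ #C - 1 := by
    intro v hv
    have : #{t ∈ C | H.Adj v t} < #C := by
      refine card_lt_card ⟨filter_subset _ _, fun h => ?_⟩
      have := h hv
      simp at this
    have : #{t ∈ C | H.Adj v t} + 1 ≤ #C := this
    have : (#{t ∈ C | H.Adj v t} : ℝ) + 1 ≤ #C := by exact_mod_cast this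
    linarith
  have hyz : ∀ s ∈ S, y s * (w * #{t ∈ C | H.Adj s t}) ≤ 2 * (w * (#C - 1)) := by
    intro s hs
    have hs' := hSC hs
    rcases Finset.eq_empty_or_nonempty ({t ∈ C | H.Adj s t}) with h | ⟨t, ht⟩
    · rw [h]
      simp only [card_empty, Nat.cast_zero, mul_zero]
      have : 0 ≤ (#C : ℝ) - 1 := by linarith
      positivity
    · rw [mem_filter] at ht
      have h1 := hedge s t ht.2
      have h2 := hy0 t ht.1
      have h3 : w * #{t ∈ C | H.Adj s t} ≤ w * (#C - 1) :=
        mul_le_mul_of_nonneg_left (hz s hs') hw.le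
      exact mul_le_mul (by linarith) h3 (by positivity) (by norm_num)
  have hsum : ∑ s ∈ S, y s * (w * #{t ∈ C | H.Adj s t}) ≤ #S * (2 * (w * (#C - 1))) := by
    simpa using sum_le_card_nsmul S _ _ hyz
  by_cases hA : w * ((#C : ℝ) - 1) ≤ 2 / 3
  · by_cases hA' : w * ((#C : ℝ) - 1) ≤ 7 / 15
    · nlinarith
    · nlinarith
  push Not at hA
  have hn : (31 : ℝ) ≤ #C := by nlinarith
  have hcharge : ∀ s ∈ S, y s * (w * #{t ∈ C | H.Adj s t}) - 14 / 15 ≤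
      ∑ t ∈ C, if H.Adj s t then w * (31 / 21 * y s - 4 / 3) else 0 := by
    intro s hs
    have h1 := hyC s (hSC hs)
    rw [← sum_filter, sum_const, nsmul_eq_mul]
    set z := w * (#{t ∈ C | H.Adj s t} : ℝ) with hzdef
    have hz0 : 0 ≤ z := by positivity
    have : (#{t ∈ C | H.Adj s t} : ℝ) * (w * (31 / 21 * y s - 4 / 3)) =
        z * (31 / 21 * y s - 4 / 3) := by rw [hzdef]; ring
    rw [this]
    nlinarith [sq_nonneg (z - 7 / 5), mul_le_mul_of_nonneg_left h1 hz0]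
  have hrecv : ∀ t ∈ C, (∑ s ∈ S, if H.Adj s t then w * (31 / 21 * y s - 4 / 3) else 0)
      ≤ 9 / 20 := by
    intro t ht
    rw [← sum_filter]
    have h1 : ∀ s ∈ S.filter (fun s => H.Adj s t), w * (31 / 21 * y s - 4 / 3) ≤
        w * (34 / 21 - 31 / 21 * y t) := by
      intro s hs
      have := hedge s t (mem_filter.1 hs).2
      exact mul_le_mul_of_nonneg_left (by linarith) hw.le
    refine (sum_le_card_nsmul _ _ _ h1).trans ?_
    rw [nsmul_eq_mul]
    set z := w * (#(S.filter (fun s => H.Adj s t)) : ℝ) with hzdef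
    have hz0 : 0 ≤ z := by positivity
    have hzy : z ≤ y t := by
      refine le_trans (mul_le_mul_of_nonneg_left ?_ hw.le) (hyC t ht)
      exact_mod_cast card_le_card fun s hs => by
        rw [mem_filter] at hs ⊢
        exact ⟨hSC hs.1, hs.2.symm⟩
    have : (#(S.filter (fun s => H.Adj s t)) : ℝ) * (w * (34 / 21 - 31 / 21 * y t)) =
        z * (34 / 21 - 31 / 21 * y t) := by rw [hzdef]; ring
    rw [this]
    nlinarith [sq_nonneg (z - 17 / 31), mul_le_mul_of_nonneg_left hzy hz0]
  have h1 := sum_le_sum hcharge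
  rw [sum_comm] at h1
  have h2 := h1.trans (sum_le_card_nsmul _ _ _ hrecv)
  rw [sum_sub_distrib, sum_const, nsmul_eq_mul, nsmul_eq_mul] at h2
  linarith

open Finset in
open Classical in
lemma sum_over_barrier_le {V : Type*} [Fintype V] (H : SimpleGraph V) (U S : Finset V)
    (y : V → ℝ) (w : ℝ) (hw : 0 < w) (hy : ∀ v, y v = w * #{t | H.Adj v t})
    (hedge : ∀ u v, H.Adj u v → y u + y v ≤ 2) :
    ∑ s ∈ S, y s * (w * #{t ∈ U | H.Adj s t}) ≤ #U := by
  have h1 : ∀ s ∈ S, y s * (w * #{t ∈ U | H.Adj s t}) =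
      ∑ t ∈ U, if H.Adj s t then w * y s else 0 := by
    intro s _
    rw [← sum_filter, sum_const, nsmul_eq_mul]
    ring
  rw [sum_congr rfl h1, sum_comm]
  have h2 : ∀ t ∈ U, (∑ s ∈ S, if H.Adj s t then w * y s else 0) ≤ 1 := by
    intro t _
    rw [← sum_filter]
    have h1 : ∀ s ∈ S.filter (fun s => H.Adj s t), w * y s ≤ w * (2 - y t) := by
      intro s hs
      have := hedge s t (mem_filter.1 hs).2
      exact mul_le_mul_of_nonneg_left (by linarith) hw.le
    refine (sum_le_card_nsmul _ _ _ h1).trans ?_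
    rw [nsmul_eq_mul]
    set z := w * (#(S.filter (fun s => H.Adj s t)) : ℝ) with hzdef
    have hz0 : 0 ≤ z := by positivity
    have hzy : z ≤ y t := by
      rw [hy]
      refine mul_le_mul_of_nonneg_left ?_ hw.le
      exact_mod_cast card_le_card fun s hs => by
        rw [mem_filter] at hs ⊢
        exact ⟨mem_univ _, hs.2.symm⟩
    have : (#(S.filter (fun s => H.Adj s t)) : ℝ) * (w * (2 - y t)) = z * (2 - y t) := by
      rw [hzdef]; ring
    rw [this]
    nlinarith [sq_nonneg (z - 1), mul_le_mul_of_nonneg_left hzy hz0]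
  simpa using sum_le_card_nsmul U _ _ h2

open Finset in
open Classical in
/-- `S` is a set of endpoints of pairs `{s, p s}` of large total degree; it meets few of the
classes of a labelling that `H` respects. -/
lemma mul_card_labels_le {V ι : Type*} [Fintype V] [Fintype ι] (H : SimpleGraph V)
    (c : V → Option ι) (hc : ∀ u v, H.Adj u v → c u = none ∨ c v = none ∨ c u = c v)
    (y : V → ℝ) (w : ℝ) (hw : 0 < w) (hw45 : 45 * w ≤ 1)
    (hy : ∀ v, y v = w * #{t | H.Adj v t})
    (hedge : ∀ u v, H.Adj u v → y u + y v ≤ 2)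
    (p : V → V) (hp : ∀ v, p (p v) = v) (S : Finset V) (hpS : ∀ s ∈ S, p s ∈ S)
    (hcS : ∀ s ∈ S, c s ≠ none)
    (hS : ∀ s ∈ S, 2 - 3 * w ≤ y s + y (p s)) :
    (1 - 3 * w) * #{i | ∃ s ∈ S, c s = some i} ≤
      ((#{v | c v = none} + ∑ i, #{v | c v = some i} / 2 : ℕ) : ℝ) := by
  have hsq : (1 - 3 * w) * #S ≤ ∑ s ∈ S, y s ^ 2 := by
    have h1 : ∑ s ∈ S, y (p s) ^ 2 = ∑ s ∈ S, y s ^ 2 :=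
      sum_nbij' p p hpS hpS (fun v _ => hp v) (fun v _ => hp v) (fun _ _ => rfl)
    have h2 : ∀ s ∈ S, 2 * (1 - 3 * w) ≤ y s ^ 2 + y (p s) ^ 2 := by
      intro s hs
      have := hS s hs
      nlinarith [sq_nonneg (y s - y (p s)), mul_self_le_mul_self (by linarith) this]
    have h3 := card_nsmul_le_sum _ _ _ h2
    rw [sum_add_distrib, h1, nsmul_eq_mul] at h3
    linarith
  have hsplit : ∀ s ∈ S, y s ^ 2 =
      y s * (w * #{t ∈ ({v | c v = none} : Finset V) | H.Adj s t}) +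
      y s * (w * #{t ∈ ({v | c v = c s} : Finset V) | H.Adj s t}) := by
    intro s hs
    have h1 : #{t | H.Adj s t} = #{t ∈ ({v | c v = none} : Finset V) | H.Adj s t} +
        #{t ∈ ({v | c v = c s} : Finset V) | H.Adj s t} := by
      rw [← card_union_of_disjoint]
      · congr 1
        ext t
        simp only [mem_filter, mem_univ, true_and, mem_union]
        constructor
        · intro h
          rcases hc s t h with h' | h' | h'
          · exact absurd h' (hcS s hs)
          · exact Or.inl ⟨h', h⟩
          · exact Or.inr ⟨h'.symm, h⟩
        · rintro (h | h) <;> exact h.2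
      · rw [Finset.disjoint_left]
        intro t ht ht'
        simp only [mem_filter, mem_univ, true_and] at ht ht'
        exact hcS s hs (ht'.1 ▸ ht.1)
    rw [pow_two]
    nth_rewrite 2 [hy s]
    rw [h1]
    push_cast
    ring
  rw [sum_congr rfl hsplit, sum_add_distrib] at hsq
  have hU := sum_over_barrier_le H {v | c v = none} S y w hw hy hedge
  have hfib : ∑ s ∈ S, y s * (w * #{t ∈ ({v | c v = c s} : Finset V) | H.Adj s t}) =
      ∑ i, ∑ s ∈ S with c s = some i,
        y s * (w * #{t ∈ ({v | c v = some i} : Finset V) | H.Adj s t}) := by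
    rw [← sum_fiberwise S c, Fintype.sum_option]
    have : S.filter (fun s => c s = none) = ∅ := by
      rw [filter_eq_empty_iff]
      exact fun s hs => hcS s hs
    rw [this, sum_empty, zero_add]
    refine sum_congr rfl fun i _ => sum_congr rfl fun s hs => ?_
    rw [(mem_filter.1 hs).2]
  have hcardS : (#S : ℝ) = ∑ i, (#{s ∈ S | c s = some i} : ℝ) := by
    have : #S = ∑ i, #{s ∈ S | c s = some i} := by
      rw [card_eq_sum_card_fiberwise (f := c) (t := univ) (fun _ _ => mem_coe.2 (mem_univ _)),
        Fintype.sum_option]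
      have : S.filter (fun s => c s = none) = ∅ := by
        rw [filter_eq_empty_iff]
        exact fun s hs => hcS s hs
      rw [this, card_empty, zero_add]
    exact_mod_cast this
  have hcomp : ∀ i ∈ (univ : Finset ι), ∑ s ∈ S with c s = some i,
        y s * (w * #{t ∈ ({v | c v = some i} : Finset V) | H.Adj s t}) ≤
      (1 - 3 * w) * #{s ∈ S | c s = some i} + ((#{v | c v = some i} / 2 : ℕ) : ℝ) -
        (1 - 3 * w) * (if ∃ s ∈ S, c s = some i then 1 else 0) := by
    intro i _
    split_ifs with h
    · obtain ⟨s, hs, hsi⟩ := h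
      have hne : (S.filter (fun s => c s = some i)).Nonempty := ⟨s, mem_filter.2 ⟨hs, hsi⟩⟩
      have h1 := sum_mul_inner_degree_le H {v | c v = some i} {s ∈ S | c s = some i}
        (filter_subset_filter _ (subset_univ _)) hne y w hw hw45 (fun v _ => by
          rw [hy]
          refine mul_le_mul_of_nonneg_left ?_ hw.le
          exact_mod_cast card_le_card (filter_subset_filter _ (subset_univ _))) hedge
      have h2 : (#{v | c v = some i} : ℝ) ≤ 2 * ((#{v | c v = some i} / 2 : ℕ) : ℝ) + 1 := by
        have : #{v | c v = some i} ≤ 2 * (#{v | c v = some i} / 2) + 1 := by omega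
        exact_mod_cast this
      have h3 : (1 : ℝ) ≤ #{s ∈ S | c s = some i} := by exact_mod_cast hne.card_pos
      nlinarith
    · have : S.filter (fun s => c s = some i) = ∅ := by
        rw [filter_eq_empty_iff]
        exact fun s hs hsi => h ⟨s, hs, hsi⟩
      rw [this]
      simp
  have hq : (#{i | ∃ s ∈ S, c s = some i} : ℝ) =
      ∑ i : ι, (if ∃ s ∈ S, c s = some i then 1 else 0) := by simp
  have h := sum_le_sum hcomp
  rw [← hfib, sum_sub_distrib, sum_add_distrib, ← mul_sum, ← mul_sum, ← hcardS, ← hq] at h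
  push_cast
  linarith

open Finset in
open Classical in
lemma card_moved_le {V ι : Type*} [Fintype V] [Fintype ι] (c : V → Option ι) (p : V → V)
    (hp : ∀ v, p (p v) = v) (S : Finset V)
    (hS : ∀ v, c v ≠ none → c (p v) ≠ none → c v ≠ c (p v) → v ∈ S) :
    #{v | p v ≠ v} ≤ 2 * (#{v | c v = none} + ∑ i, #{v | c v = some i} / 2) +
      #{i | ∃ s ∈ S, c s = some i} := by
  have hpinj : Function.Injective p := fun a b h => by rw [← hp a, h, hp]
  have hone : #({v | p v ≠ v} : Finset V) = #{v ∈ ({v | p v ≠ v} : Finset V) | c v = none} +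
      ∑ i, #{v ∈ ({v | p v ≠ v} : Finset V) | c v = some i} := by
    rw [card_eq_sum_card_fiberwise (f := c) (t := univ) (fun _ _ => mem_coe.2 (mem_univ _)),
      Fintype.sum_option]
  have hnone : #{v ∈ ({v | p v ≠ v} : Finset V) | c v = none} ≤ #{v | c v = none} :=
    card_le_card (filter_subset_filter _ (subset_univ _))
  have hpnone : ∑ i, #{v | c v = some i ∧ c (p v) = none} ≤ #{v | c v = none} := by
    have h1 : #({v | c (p v) = none} : Finset V) ≤ #{v | c v = none} :=
      card_le_card_of_injOn p (fun v hv => by simpa using hv) hpinj.injOn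
    rw [card_eq_sum_card_fiberwise (f := c) (t := univ) (fun _ _ => mem_coe.2 (mem_univ _)),
      Fintype.sum_option] at h1
    simp only [filter_filter] at h1
    simp only [and_comm (a := c (p _) = none)] at h1
    omega
  have hcomp : ∀ i ∈ (univ : Finset ι), #{v ∈ ({v | p v ≠ v} : Finset V) | c v = some i} ≤
      #{v | c v = some i ∧ c (p v) = none} + (2 * (#{v | c v = some i} / 2) +
        if ∃ s ∈ S, c s = some i then 1 else 0) := by
    intro i _
    have h1 : #{v ∈ ({v | p v ≠ v} : Finset V) | c v = some i} ≤
        #{v | c v = some i ∧ c (p v) = none} +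
        #{v | p v ≠ v ∧ c v = some i ∧ c (p v) ≠ none} := by
      refine (card_le_card ?_).trans (card_union_le _ _)
      intro v hv
      simp only [mem_filter, mem_univ, true_and, mem_union] at hv ⊢
      tauto
    have h2 : #{v | p v ≠ v ∧ c v = some i ∧ c (p v) ≠ none} ≤ #{v | c v = some i} :=
      card_le_card fun v hv => by
        simp only [mem_filter, mem_univ, true_and] at hv ⊢
        exact hv.2.1
    split_ifs with h
    · omega
    · have heq : ∀ v, c v = some i → c (p v) ≠ none → c (p v) = some i := by
        intro v hv hv'
        by_contra hne
        exact h ⟨v, hS v (by simp [hv]) hv' (fun h => hne (h ▸ hv)), hv⟩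
      have heven : Even #{v | p v ≠ v ∧ c v = some i ∧ c (p v) ≠ none} := by
        refine even_card_of_involution _ p hp (fun v hv => ?_) (fun v hv => ?_)
        · simp only [mem_filter, mem_univ, true_and] at hv ⊢
          refine ⟨fun h => hv.1 (hpinj h), heq v hv.2.1 hv.2.2, ?_⟩
          rw [hp, hv.2.1]
          simp
        · exact (mem_filter.1 hv).2.1
      rw [Nat.even_iff] at heven
      omega
  have h := sum_le_sum hcomp
  rw [sum_add_distrib, sum_add_distrib, ← mul_sum] at h
  have hq : #{i | ∃ s ∈ S, c s = some i} = ∑ i : ι, (if ∃ s ∈ S, c s = some i then 1 else 0) := by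
    simp
  omega

lemma matchNum_mono {V : Type*} [Fintype V] {G G' : SimpleGraph V} (h : G ≤ G') :
    matchNum G ≤ matchNum G' := by
  classical
  obtain ⟨p, hp, hG, hcard⟩ := exists_involution_card_eq G
  have := card_le_two_mul_matchNum G' p hp fun v hv => h (hG v hv)
  omega

open Finset in
open Classical in
lemma deg_eq_card {V : Type*} [Fintype V] (G : SimpleGraph V) (v : V) :
    deg G v = #{t | G.Adj v t} := by
  rw [deg, ← Set.ncard_coe_finset]
  congr 1
  ext; simp

open Finset in
open Classical in
/-- An EDCS-type bound relative to the graph whose maximum matching is `p`: edges of `H` have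
total degree at most `B`, and pairs `{v, p v}` missing from `H` have total degree at least
`B - 3`. -/
lemma card_moved_le_of_edge_degree {V : Type u} [Fintype V] (H : SimpleGraph V) (B : ℝ)
    (hB : 90 ≤ B) (hup : ∀ u v, H.Adj u v → (deg H u : ℝ) + deg H v ≤ B)
    (p : V → V) (hp : ∀ v, p (p v) = v)
    (hlow : ∀ v, p v ≠ v → ¬ H.Adj v (p v) → B - 3 ≤ (deg H v : ℝ) + deg H (p v)) :
    (1 - 6 / B) * ((#{v | p v ≠ v} : ℝ) - 2 * matchNum H) ≤ matchNum H := by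
  obtain ⟨ι, _, c, hc, hμ⟩ := exists_tutteBerge_labelling H
  have hB0 : 0 < B := by linarith
  let S : Finset V := {v | c v ≠ none ∧ c (p v) ≠ none ∧ c v ≠ c (p v)}
  have hSmem : ∀ v, v ∈ S ↔ c v ≠ none ∧ c (p v) ≠ none ∧ c v ≠ c (p v) := by simp [S]
  have hmoved := card_moved_le c p hp S fun v h1 h2 h3 => (hSmem v).2 ⟨h1, h2, h3⟩
  have hlabels := mul_card_labels_le H c hc (fun v => 2 / B * deg H v) (2 / B) (by positivity)
    (by rw [mul_div_assoc', div_le_one hB0]; linarith)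
    (fun v => by rw [deg_eq_card])
    (fun u v huv => by
      have h1 := mul_le_mul_of_nonneg_left (hup u v huv) (show 0 ≤ 2 / B by positivity)
      rw [mul_add, div_mul_cancel₀ _ hB0.ne'] at h1
      exact h1)
    p hp S (fun s hs => by
      rw [hSmem] at hs ⊢
      rw [hp]
      exact ⟨hs.2.1, hs.1, hs.2.2.symm⟩)
    (fun s hs => ((hSmem s).1 hs).1)
    (fun s hs => by
      obtain ⟨h1, h2, h3⟩ := (hSmem s).1 hs
      have hne : p s ≠ s := fun h => h3 (by rw [h])
      have hnadj : ¬ H.Adj s (p s) := fun h => by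
        rcases hc _ _ h with h | h | h
        exacts [h1 h, h2 h, h3 h]
      have h4 := mul_le_mul_of_nonneg_left (hlow s hne hnadj) (show 0 ≤ 2 / B by positivity)
      rw [mul_add, mul_sub, div_mul_cancel₀ _ hB0.ne'] at h4
      linarith)
  have h6 : 1 - 3 * (2 / B) = 1 - 6 / B := by ring
  rw [h6] at hlabels
  have hpos : 0 ≤ 1 - 6 / B := by
    rw [sub_nonneg, div_le_one hB0]
    linarith
  have hμ' : ((#{v | c v = none} + ∑ i, #{v | c v = some i} / 2 : ℕ) : ℝ) ≤ matchNum H := by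
    exact_mod_cast hμ
  have hmoved' : (#{v | p v ≠ v} : ℝ) - 2 * matchNum H ≤ #{i | ∃ s ∈ S, c s = some i} := by
    have : #{v | p v ≠ v} ≤ 2 * matchNum H + #{i | ∃ s ∈ S, c s = some i} := by omega
    have : (#{v | p v ≠ v} : ℝ) ≤ 2 * matchNum H + #{i | ∃ s ∈ S, c s = some i} := by
      exact_mod_cast this
    linarith
  exact (mul_le_mul_of_nonneg_left hmoved' hpos).trans (hlabels.trans hμ')

lemma le_edcs_parameter {ε : ℝ} (hε0 : 0 < ε) (hε : ε < 1 / 2) :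
    88 ≤ 32 / ε ^ 2 * Real.log (1 / ε) ∧ 6 ≤ ε * (32 / ε ^ 2 * Real.log (1 / ε)) := by
  have hlog : 0.6931 ≤ Real.log (1 / ε) := by
    have h1 : Real.log 2 ≤ Real.log (1 / ε) :=
      Real.log_le_log (by norm_num) (by rw [le_div_iff₀ hε0]; linarith)
    linarith [Real.log_two_gt_d9]
  have h2 : 4 ≤ 1 / ε ^ 2 := by
    rw [le_div_iff₀ (by positivity)]
    nlinarith
  have h3 : 2 ≤ 1 / ε := by
    rw [le_div_iff₀ hε0]
    linarith
  have e1 : 32 / ε ^ 2 * Real.log (1 / ε) = 32 * (1 / ε ^ 2 * Real.log (1 / ε)) := by ring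
  have e2 : ε * (32 / ε ^ 2 * Real.log (1 / ε)) = 32 * (1 / ε * Real.log (1 / ε)) := by
    field_simp
  rw [e2, e1]
  constructor
  · nlinarith
  · nlinarith


/-- One-way communication protocol for matching: if Alice sends an EDCS `H` of her graph
`G_A` with parameters `(β, β-1)` where `β = 32·ε⁻²·log(1/ε)`, then
`μ(G_A ∪ G_B) ≤ (3/2 + ε)·μ(H ∪ G_B)`. -/
theorem stmt14 {V : Type*} [Fintype V] (GA GB H : SimpleGraph V) (hH : H ≤ GA)
    (ε : ℝ) (hε0 : 0 < ε) (hε : ε < 1/2)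
    (β : ℝ) (hβ : β = 32 / ε ^ 2 * Real.log (1 / ε))
    (hP1 : ∀ u v, H.Adj u v → ((deg H u : ℝ) + deg H v) ≤ β)
    (hP2 : ∀ u v, GA.Adj u v → ¬ H.Adj u v → β - 1 ≤ ((deg H u : ℝ) + deg H v)) :
    (matchNum (GA ⊔ GB) : ℝ) ≤ (3/2 + ε) * matchNum (H ⊔ GB) := by
  classical
  obtain ⟨p, hp, hG, hcard⟩ := exists_involution_card_eq (GA ⊔ GB)
  obtain ⟨hβ88, hεβ⟩ := le_edcs_parameter hε0 hε
  rw [← hβ] at hβ88 hεβ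
  -- matching edges of `GB` of small `H`-degree
  let K : SimpleGraph V :=
    { Adj := fun u v => p u = v ∧ u ≠ v ∧ GB.Adj u v ∧ (deg H u : ℝ) + deg H v ≤ β
      symm := ⟨by
        rintro u v ⟨rfl, h1, h2, h3⟩
        exact ⟨hp u, h1.symm, h2.symm, by rwa [add_comm]⟩⟩
      loopless := ⟨fun _ h => h.2.1 rfl⟩ }
  have hKB : K ≤ GB := fun u v h => h.2.2.1
  have hle : ∀ v, (deg H v : ℝ) ≤ deg (H ⊔ K) v := fun v => by
    exact_mod_cast Set.ncard_le_ncard fun t ht => Or.inl ht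
  have hge : ∀ v, (deg (H ⊔ K) v : ℝ) ≤ deg H v + 1 := fun v => by
    have h1 : (H ⊔ K).neighborSet v ⊆ insert (p v) (H.neighborSet v) := by
      rintro t (ht | ht)
      · exact Or.inr ht
      · exact Or.inl ht.1.symm
    exact_mod_cast (Set.ncard_le_ncard h1).trans (Set.ncard_insert_le _ _)
  have hup : ∀ u v, (H ⊔ K).Adj u v → (deg (H ⊔ K) u : ℝ) + deg (H ⊔ K) v ≤ β + 2 := by
    rintro u v (h | h)
    · linarith [hP1 u v h, hge u, hge v]
    · linarith [h.2.2.2, hge u, hge v]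
  have hlow : ∀ v, p v ≠ v → ¬ (H ⊔ K).Adj v (p v) →
      β + 2 - 3 ≤ (deg (H ⊔ K) v : ℝ) + deg (H ⊔ K) (p v) := by
    intro v hv hnadj
    have hnH : ¬ H.Adj v (p v) := fun h => hnadj (Or.inl h)
    have hdeg : β - 1 ≤ (deg H v : ℝ) + deg H (p v) := by
      rcases hG v hv with h | h
      · exact hP2 _ _ h hnH
      · by_contra hlt
        exact hnadj (Or.inr ⟨rfl, hv.symm, h, by linarith⟩)
    linarith [hle v, hle (p v)]
  have hmain := card_moved_le_of_edge_degree (H ⊔ K) (β + 2) (by linarith) hup p hp hlow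
  have hmono : (matchNum (H ⊔ K) : ℝ) ≤ matchNum (H ⊔ GB) := by
    exact_mod_cast matchNum_mono (sup_le_sup_left hKB H)
  rw [hcard] at hmain
  push_cast at hmain
  set m : ℝ := (matchNum (GA ⊔ GB) : ℝ)
  set m' : ℝ := (matchNum (H ⊔ K) : ℝ)
  have hm' : 0 ≤ m' := Nat.cast_nonneg _
  have hκ : 1 ≤ (1 + 2 * ε) * (1 - 6 / (β + 2)) := by
    have hB : 0 < β + 2 := by linarith
    have h1 : (1 + 2 * ε) * (1 - 6 / (β + 2)) - 1 =
        (2 * ε * (β + 2) - 6 * (1 + 2 * ε)) / (β + 2) := by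
      field_simp
      ring
    have h2 : 0 ≤ (2 * ε * (β + 2) - 6 * (1 + 2 * ε)) / (β + 2) :=
      div_nonneg (by nlinarith) hB.le
    linarith
  have hgap : 2 * m - 2 * m' ≤ (1 + 2 * ε) * m' := by
    by_cases hneg : 2 * m - 2 * m' ≤ 0
    · exact hneg.trans (by positivity)
    · have h1 := mul_le_mul_of_nonneg_left hmain (show 0 ≤ 1 + 2 * ε by linarith)
      nlinarith
  nlinarith
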